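/- arXiv:math/9807097 — 2 statements merged into one kernel-verified Lean document; each statement's English description precedes it below -/
import Mathlib

section
/- A proper k-subspace L ⊂ U(b_+) is a left crossed submodule under the left adjoint action and the left regular coaction if and only if L = L_(l,I) for a (unique) pair (l,I) with l ∈ ℕ_0 and I ⊂ ℕ finite. Moreover L_(l,I) is finite-dimensional if and only if l = 0, and dim L_(0,I) = ∑_{n∈I} n. -/
open scoped TensorProduct

noncomputable section

namespace UBorel

variable (k : Type*) [Field k] [CharZero k]

/-- The underlying space of `U(b_+)`: the free `k`-module with basis indexed
by `(n, m)`, the index `(n, m)` standing for the monomial `X^n H^m`. -/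
abbrev UU := (ℕ × ℕ) →₀ k

/-- The basis monomial `X^n H^m`. -/
def umono (n m : ℕ) : UU k := Finsupp.single (n, m) 1

/-- The left adjoint action of `H`: `H ▷ X^n H^m = n X^n H^m`. -/
def adH : UU k →ₗ[k] UU k :=
  Finsupp.lsum k fun p =>
    LinearMap.toSpanSingleton k (UU k) ((p.1 : k) • umono k p.1 p.2)

/-- The left adjoint action of `X`:
`X ▷ X^n H^m = X^{n+1}(H^m - (H+1)^m) = -∑_{j<m} (m choose j) X^{n+1} H^j`. -/
def adXU : UU k →ₗ[k] UU k :=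
  Finsupp.lsum k fun p =>
    LinearMap.toSpanSingleton k (UU k)
      (∑ j ∈ Finset.range p.2, (-(p.2.choose j : k)) • umono k (p.1 + 1) j)

/-- The component of the coproduct
`Δ(X^n H^m) = ∑_{i≤n} ∑_{j≤m} (n choose i)(m choose j) X^i H^j ⊗ X^{n-i} H^{m-j}`
(viewed as a left coaction) along the basis element `X^a H^b` of the left
tensor factor. -/
def ucopComp (a b : ℕ) : UU k →ₗ[k] UU k :=
  Finsupp.lsum k fun p =>
    LinearMap.toSpanSingleton k (UU k)
      (if a ≤ p.1 ∧ b ≤ p.2 then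
        ((p.1.choose a * p.2.choose b : ℕ) : k) • umono k (p.1 - a) (p.2 - b)
      else 0)

/-- The counit: `ε(X^n H^m) = δ_{n,0} δ_{m,0}`. -/
def ucou : UU k →ₗ[k] k :=
  Finsupp.lsum k fun p => if p = (0, 0) then LinearMap.id else 0

/-- A left crossed `U(b_+)`-submodule of `U(b_+)`: stable under the left
adjoint action (of the generators `H` and `X`, hence of all of `U(b_+)`) and
under the left regular coaction `Δ`. -/
def IsCrossedU (L : Submodule k (UU k)) : Prop :=
  (∀ v ∈ L, adH k v ∈ L) ∧ (∀ v ∈ L, adXU k v ∈ L) ∧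
  (∀ a b : ℕ, ∀ v ∈ L, ucopComp k a b v ∈ L)

/-- The projection `x ↦ x - ε(x)·1` onto `ker ε`. -/
def uprojE : UU k →ₗ[k] UU k :=
  LinearMap.id - (Finsupp.lsingle (0, 0)).comp (ucou k)

/-- A left crossed submodule of `ker ε ⊂ U(b_+)` under the left adjoint action
and the projected left regular coaction. -/
def IsCrossedEU (L : Submodule k (UU k)) : Prop :=
  L ≤ LinearMap.ker (ucou k) ∧
  (∀ v ∈ L, adH k v ∈ L) ∧ (∀ v ∈ L, adXU k v ∈ L) ∧
  (∀ a b : ℕ, ∀ v ∈ L, (uprojE k).comp (ucopComp k a b) v ∈ L)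

/-- The set of monomials spanning `L_(l,I)`: all `X^a H^b` with `b < l`,
together with, for `0 ≤ j < |I|`, the `X^a H^{l+j}` with `a < n_{j+1}`, where
`n_{j+1}` is the `(j+1)`-st largest element of `I` (characterised by having
exactly `j` elements of `I` above it). -/
def Lmon (l : ℕ) (I : Finset ℕ) : Set (UU k) :=
  {v | ∃ a b : ℕ, v = umono k a b ∧
    (b < l ∨ (l ≤ b ∧ ∃ n ∈ I, (I.filter fun x => n < x).card = b - l ∧ a < n))}

/-- The crossed submodule `L_(l,I) ⊆ U(b_+)`. -/
def Lsub (l : ℕ) (I : Finset ℕ) : Submodule k (UU k) :=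
  Submodule.span k (Lmon k l I)

/-- The crossed submodule `L'_(l,I) = L_(l,I) ∩ ker ε ⊆ ker ε ⊂ U(b_+)`:
the span of the same monomials with the constant monomial `1` removed. -/
def Lsub' (l : ℕ) (I : Finset ℕ) : Submodule k (UU k) :=
  Submodule.span k (Lmon k l I \ {umono k 0 0})

end UBorel

namespace UBorel

/-- The set of exponents of the monomials spanning `L_(l,I)`. -/
def stair (l : ℕ) (I : Finset ℕ) : Set (ℕ × ℕ) :=
  {p | p.2 < l ∨ (l ≤ p.2 ∧ ∃ n ∈ I, (I.filter fun x => n < x).card = p.2 - l ∧ p.1 < n)}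

/-- Sets of exponents closed under `(a + 1, b) ↦ (a, b)` and `(a, b + 1) ↦ (a + 1, b)`. -/
def IsStair (S : Set (ℕ × ℕ)) : Prop :=
  (∀ a b, (a + 1, b) ∈ S → (a, b) ∈ S) ∧ (∀ a b, (a, b + 1) ∈ S → (a + 1, b) ∈ S)

theorem IsStair.mem_of_le {S : Set (ℕ × ℕ)} (hS : IsStair S) {a a' b b' : ℕ} (ha : a' ≤ a)
    (hb : b' ≤ b) (h : (a, b) ∈ S) : (a', b') ∈ S := by
  induction hb with
  | refl =>
    induction ha with
    | refl => exact h
    | step _ ih => exact ih (hS.1 _ _ h)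
  | step _ ih => exact ih (hS.1 _ _ (hS.2 _ _ h))

theorem IsStair.succ_mem_of_lt {S : Set (ℕ × ℕ)} (hS : IsStair S) {a b b' : ℕ} (hb : b' < b)
    (h : (a, b) ∈ S) : (a + 1, b') ∈ S := by
  obtain ⟨c, rfl⟩ := Nat.exists_eq_add_of_lt hb
  exact hS.mem_of_le le_rfl (Nat.le_add_right _ _) (hS.2 _ _ h)

/-- An element of `I` is determined by the number of elements of `I` above it. -/
theorem eq_of_card_filter_lt_eq {I : Finset ℕ} {m n : ℕ} (hm : m ∈ I) (hn : n ∈ I)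
    (h : (I.filter fun x => m < x).card = (I.filter fun x => n < x).card) : m = n := by
  have key : ∀ {m n : ℕ}, n ∈ I → m < n →
      (I.filter fun x => n < x).card < (I.filter fun x => m < x).card := by
    intro m n hn hmn
    refine Finset.card_lt_card (Finset.ssubset_iff_of_subset ?_ |>.2 ⟨n, ?_, ?_⟩)
    · exact Finset.monotone_filter_right _ fun x _ hx => hmn.trans hx
    · simp [hn, hmn]
    · simp
  rcases lt_trichotomy m n with hlt | rfl | hlt
  · exact absurd h (key hn hlt).ne'
  · rfl
  · exact absurd h (key hm hlt).ne

theorem exists_gt_card_filter_lt {I : Finset ℕ} {n r : ℕ}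
    (h : (I.filter fun x => n < x).card = r + 1) :
    ∃ n' ∈ I, n < n' ∧ (I.filter fun x => n' < x).card = r := by
  have hne : (I.filter fun x => n < x).Nonempty := Finset.card_pos.1 (by omega)
  have hmem := Finset.min'_mem _ hne
  set n' := (I.filter fun x => n < x).min' hne
  obtain ⟨hI, hlt⟩ := Finset.mem_filter.1 hmem
  refine ⟨n', hI, hlt, ?_⟩
  have : (I.filter fun x => n' < x) = (I.filter fun x => n < x).erase n' := by
    ext x
    simp only [Finset.mem_filter, Finset.mem_erase]
    constructor
    · rintro ⟨hx, hx'⟩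
      exact ⟨hx'.ne', hx, hlt.trans hx'⟩
    · rintro ⟨hx, hx', hx''⟩
      exact ⟨hx', lt_of_le_of_ne (Finset.min'_le _ _ (by simp [hx', hx''])) (Ne.symm hx)⟩
  rw [this, Finset.card_erase_of_mem hmem, h, Nat.add_sub_cancel]

theorem isStair_stair (l : ℕ) (I : Finset ℕ) : IsStair (stair l I) := by
  refine ⟨fun a b => ?_, fun a b => ?_⟩
  · rintro (h | ⟨h, n, hn, hc, ha⟩)
    · exact Or.inl h
    · exact Or.inr ⟨h, n, hn, hc, (Nat.lt_succ_self a).trans ha⟩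
  · rintro (h | ⟨h, n, hn, hc, ha⟩)
    · exact Or.inl ((Nat.lt_succ_self b).trans h)
    · rcases lt_or_ge b l with hb | hb
      · exact Or.inl hb
      · have hc' : (I.filter fun x => n < x).card = (b - l) + 1 := by
          simp only at hc; omega
        obtain ⟨n', hn', hlt, hc''⟩ := exists_gt_card_filter_lt hc'
        exact Or.inr ⟨hb, n', hn', hc'', by simp only at ha ⊢; omega⟩

theorem mem_stair_iff_lt {l : ℕ} {I : Finset ℕ} {n : ℕ} (hn : n ∈ I) (a : ℕ) :
    (a, l + (I.filter fun x => n < x).card) ∈ stair l I ↔ a < n := by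
  constructor
  · rintro (h | ⟨-, n', hn', hc, ha⟩)
    · simp only at h; omega
    · rwa [eq_of_card_filter_lt_eq hn hn' (by simp only at hc; omega)]
  · exact fun h => Or.inr ⟨Nat.le_add_right _ _, n, hn, by simp, h⟩

theorem notMem_stair_of_card_le {l : ℕ} {I : Finset ℕ} {a b : ℕ} (hb : l + I.card ≤ b) :
    (a, b) ∉ stair l I := by
  rintro (h | ⟨-, n, hn, hc, -⟩)
  · simp only at h; omega
  · have : (I.filter fun x => n < x).card < I.card :=
      Finset.card_lt_card (Finset.filter_ssubset.2 ⟨n, hn, lt_irrefl n⟩)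
    simp only at hc; omega

theorem exists_notMem_stair {l : ℕ} {I : Finset ℕ} {b : ℕ} (hb : l ≤ b) :
    ∃ a, (a, b) ∉ stair l I := by
  refine ⟨I.sup id, ?_⟩
  rintro (h | ⟨-, n, hn, -, ha⟩)
  · simp only at h; omega
  · exact absurd (Finset.le_sup (f := id) hn) (not_le.2 ha)

theorem lt_iff_forall_mem_stair {l : ℕ} {I : Finset ℕ} {b : ℕ} :
    b < l ↔ ∀ a, (a, b) ∈ stair l I := by
  refine ⟨fun h a => Or.inl h, fun h => ?_⟩
  by_contra hb
  obtain ⟨a, ha⟩ := exists_notMem_stair (I := I) (not_lt.1 hb)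
  exact ha (h a)

theorem mem_iff_exists_column {l : ℕ} {I : Finset ℕ} (h0 : 0 ∉ I) {n : ℕ} :
    n ∈ I ↔ n ≠ 0 ∧ ∃ b, ∀ a, (a, b) ∈ stair l I ↔ a < n := by
  constructor
  · exact fun hn => ⟨fun h => h0 (h ▸ hn), _, mem_stair_iff_lt hn⟩
  · rintro ⟨hn, b, hb⟩
    rcases (hb (n - 1)).2 (by omega) with h | ⟨h, n', hn', hc, -⟩
    · exact absurd ((hb n).1 (Or.inl h)) (lt_irrefl n)
    · have hc' : b = l + (I.filter fun x => n' < x).card := by simp only at hc h; omega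
      have key : ∀ a, a < n ↔ a < n' := fun a => by
        rw [← hb a, hc', mem_stair_iff_lt hn']
      have : n = n' := by
        have h1 := key n
        have h2 := key n'
        omega
      rwa [this]

theorem stair_injective {l l' : ℕ} {I I' : Finset ℕ} (h0 : 0 ∉ I) (h0' : 0 ∉ I')
    (h : stair l I = stair l' I') : l = l' ∧ I = I' := by
  refine ⟨?_, ?_⟩
  · have key : ∀ b, b < l ↔ b < l' := fun b => by
      rw [lt_iff_forall_mem_stair (I := I), h, ← lt_iff_forall_mem_stair]
    have h1 := key l
    have h2 := key l'
    omega
  · ext n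
    rw [mem_iff_exists_column (l := l) h0, h, ← mem_iff_exists_column h0']

theorem exists_finset_of_strict_decrease (g : ℕ → ℕ)
    (hg : ∀ j, g (j + 1) ≠ 0 → g (j + 1) < g j) :
    ∃ I : Finset ℕ, 0 ∉ I ∧ ∀ a j,
      a < g j ↔ ∃ n ∈ I, (I.filter fun x => n < x).card = j ∧ a < n := by
  have hanti : Antitone g := antitone_nat_of_succ_le fun j => by
    by_cases h : g (j + 1) = 0
    · omega
    · exact (hg j h).le
  have hlt : ∀ {i j}, i < j → g j ≠ 0 → g j < g i := by
    intro i j hij hj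
    obtain ⟨c, rfl⟩ : ∃ c, j = c + 1 := ⟨j - 1, by omega⟩
    exact (hg c hj).trans_le (hanti (by omega))
  classical
  let I : Finset ℕ := (Finset.range (g 0 + 1)).filter fun n => n ≠ 0 ∧ ∃ j, g j = n
  have hI : ∀ {n}, n ∈ I ↔ n ≠ 0 ∧ ∃ j, g j = n := by
    intro n
    simp only [I, Finset.mem_filter, Finset.mem_range, and_iff_right_iff_imp]
    rintro ⟨-, j, rfl⟩
    exact Nat.lt_succ_of_le (hanti (Nat.zero_le j))
  have hrank : ∀ j, g j ≠ 0 → (I.filter fun x => g j < x).card = j := by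
    intro j hj
    have : (I.filter fun x => g j < x) = (Finset.range j).image g := by
      ext x
      simp only [Finset.mem_filter, hI, Finset.mem_image, Finset.mem_range]
      constructor
      · rintro ⟨⟨-, i, rfl⟩, hi⟩
        exact ⟨i, lt_of_not_ge fun hij => absurd (hanti hij) (not_le.2 hi), rfl⟩
      · rintro ⟨i, hi, rfl⟩
        have := hlt hi hj
        exact ⟨⟨by omega, i, rfl⟩, this⟩
    rw [this, Finset.card_image_of_injOn, Finset.card_range]
    intro i hi i' hi' heq
    simp only [Finset.coe_range, Set.mem_Iio] at hi hi'
    have hpos := hlt hi hj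
    have hpos' := hlt hi' hj
    rcases lt_trichotomy i i' with h | h | h
    · have := hlt h (by omega)
      omega
    · exact h
    · have := hlt h (by omega)
      omega
  refine ⟨I, fun h => (hI.1 h).1 rfl, fun a j => ⟨fun h => ?_, ?_⟩⟩
  · have hj : g j ≠ 0 := by omega
    exact ⟨g j, hI.2 ⟨hj, j, rfl⟩, hrank j hj, h⟩
  · rintro ⟨n, hn, hc, ha⟩
    obtain ⟨hn0, i, rfl⟩ := hI.1 hn
    rwa [← hc, hrank i hn0]

theorem IsStair.exists_eq_stair {S : Set (ℕ × ℕ)} (hS : IsStair S) (hne : S ≠ Set.univ) :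
    ∃ l I, 0 ∉ I ∧ S = stair l I := by
  classical
  have hex : ∃ b a, (a, b) ∉ S := by
    obtain ⟨⟨a, b⟩, h⟩ := (Set.ne_univ_iff_exists_notMem S).1 hne
    exact ⟨b, a, h⟩
  set l := Nat.find hex
  have hcol : ∀ j, ∃ a, (a, l + j) ∉ S := fun j => by
    obtain ⟨a, ha⟩ := Nat.find_spec hex
    exact ⟨a, fun h => ha (hS.mem_of_le le_rfl (Nat.le_add_right _ _) h)⟩
  have hmem : ∀ a j, (a, l + j) ∈ S ↔ a < Nat.find (hcol j) := fun a j => by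
    refine ⟨fun h => lt_of_not_ge fun h' => ?_, fun h => not_not.1 (Nat.find_min _ h)⟩
    exact Nat.find_spec (hcol j) (hS.mem_of_le h' le_rfl h)
  obtain ⟨I, h0, hI⟩ := exists_finset_of_strict_decrease (fun j => Nat.find (hcol j)) fun j hj => by
    have h1 := (hmem (Nat.find (hcol (j + 1)) - 1) (j + 1)).2 (by omega)
    have h2 := (hmem _ _).1 (hS.2 _ (l + j) h1)
    omega
  refine ⟨l, I, h0, ?_⟩
  ext ⟨a, b⟩
  rcases lt_or_ge b l with hb | hb
  · have h1 : (a, b) ∈ S := by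
      by_contra h
      exact Nat.find_min hex hb ⟨a, h⟩
    exact iff_of_true h1 (Or.inl hb)
  · obtain ⟨j, rfl⟩ := Nat.exists_eq_add_of_le hb
    rw [hmem, hI]
    simp [stair]

theorem finite_stair_iff {l : ℕ} {I : Finset ℕ} : (stair l I).Finite ↔ l = 0 := by
  constructor
  · intro h
    by_contra hl
    refine Set.infinite_of_injective_forall_mem (f := fun a : ℕ => (a, 0)) ?_ ?_ h
    · exact fun a a' h => (Prod.ext_iff.1 h).1
    · exact fun a => Or.inl (Nat.pos_of_ne_zero hl)
  · rintro rfl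
    refine (Finset.finite_toSet (Finset.range (I.sup id) ×ˢ Finset.range I.card)).subset ?_
    rintro ⟨a, b⟩ h
    simp only [Finset.coe_product, Finset.coe_range, Set.mem_prod, Set.mem_Iio]
    refine ⟨?_, lt_of_not_ge fun hb => notMem_stair_of_card_le (by omega) h⟩
    rcases h with h | ⟨-, n, hn, -, ha⟩
    · simp at h
    · exact ha.trans_le (Finset.le_sup (f := id) hn)

theorem ncard_stair_zero (I : Finset ℕ) : (stair 0 I).ncard = ∑ n ∈ I, n := by
  have : stair 0 I = ((I.biUnion fun n =>
      Finset.range n ×ˢ {(I.filter fun x => n < x).card} : Finset (ℕ × ℕ)) : Set (ℕ × ℕ)) := by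
    ext ⟨a, b⟩
    simp only [stair, Set.mem_ofPred_eq, Finset.mem_coe, Finset.mem_biUnion, Finset.mem_product,
      Finset.mem_range, Finset.mem_singleton]
    constructor
    · rintro (h | ⟨-, n, hn, hc, ha⟩)
      · omega
      · exact ⟨n, hn, ha, by omega⟩
    · rintro ⟨n, hn, ha, hc⟩
      exact Or.inr ⟨by omega, n, hn, by omega, ha⟩
  rw [this, Set.ncard_coe_finset, Finset.card_biUnion]
  · simp
  · intro m hm n hn hmn
    refine Finset.disjoint_left.2 fun p hp hp' => hmn ?_
    simp only [Finset.mem_product, Finset.mem_singleton] at hp hp'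
    exact eq_of_card_filter_lt_eq hm hn (hp.2.symm.trans hp'.2)

section Linear

variable {k : Type*} [Field k]

theorem Lsub_eq_supported (l : ℕ) (I : Finset ℕ) :
    Lsub k l I = Finsupp.supported k k (stair l I) := by
  rw [Finsupp.supported_eq_span_single, Lsub]
  congr 1
  ext v
  simp only [Lmon, Set.mem_ofPred_eq, Set.mem_image, stair, umono, Prod.exists]
  constructor
  · rintro ⟨a, b, rfl, h⟩
    exact ⟨a, b, h, rfl⟩
  · rintro ⟨a, b, h, rfl⟩
    exact ⟨a, b, rfl, h⟩

theorem umono_mem_supported {S : Set (ℕ × ℕ)} {a b : ℕ} :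
    umono k a b ∈ Finsupp.supported k k S ↔ (a, b) ∈ S := by
  simp [umono, Finsupp.mem_supported]

theorem supported_injective :
    Function.Injective (Finsupp.supported k k : Set (ℕ × ℕ) → Submodule k (UU k)) := by
  intro S T h
  ext ⟨a, b⟩
  rw [← umono_mem_supported (k := k), h, umono_mem_supported]

theorem map_mem_of_mem_supported {S : Set (ℕ × ℕ)} {f : UU k →ₗ[k] UU k}
    {L : Submodule k (UU k)} (hf : ∀ a b, (a, b) ∈ S → f (umono k a b) ∈ L) {v : UU k}
    (hv : v ∈ Finsupp.supported k k S) : f v ∈ L := by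
  have : Finsupp.supported k k S ≤ L.comap f := by
    rw [Finsupp.supported_eq_span_single, Submodule.span_le]
    rintro _ ⟨⟨a, b⟩, h, rfl⟩
    exact hf a b h
  exact this hv

theorem finiteDimensional_supported_iff {S : Set (ℕ × ℕ)} :
    FiniteDimensional k (Finsupp.supported k k S) ↔ S.Finite := by
  rw [FiniteDimensional, Module.Finite.equiv_iff (Finsupp.supportedEquivFinsupp S)]
  refine ⟨fun h => ?_, fun h => ?_⟩
  · have := Module.Finite.finite_basis (Finsupp.basisSingleOne (R := k) (ι := S))
    exact S.toFinite
  · have := h.to_subtype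
    infer_instance

theorem finrank_supported (S : Set (ℕ × ℕ)) :
    Module.finrank k (Finsupp.supported k k S) = S.ncard := by
  rw [(Finsupp.supportedEquivFinsupp S).finrank_eq,
    Module.finrank_eq_nat_card_basis (Finsupp.basisSingleOne (R := k) (ι := S)),
    Nat.card_coe_set_eq]

theorem adH_umono (a b : ℕ) : adH k (umono k a b) = (a : k) • umono k a b := by
  simp [adH, umono]

theorem adXU_umono (a b : ℕ) : adXU k (umono k a b) =
    ∑ j ∈ Finset.range b, (-(b.choose j : k)) • umono k (a + 1) j := by
  simp [adXU, umono]

theorem ucopComp_umono (a b n m : ℕ) : ucopComp k a b (umono k n m) =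
    if a ≤ n ∧ b ≤ m then ((n.choose a * m.choose b : ℕ) : k) • umono k (n - a) (m - b)
      else 0 := by
  simp [ucopComp, umono]

theorem isCrossedU_supported {S : Set (ℕ × ℕ)} (hS : IsStair S) :
    IsCrossedU k (Finsupp.supported k k S) := by
  refine ⟨fun v hv => map_mem_of_mem_supported (fun a b h => ?_) hv,
    fun v hv => map_mem_of_mem_supported (fun a b h => ?_) hv,
    fun c d v hv => map_mem_of_mem_supported (fun a b h => ?_) hv⟩
  · rw [adH_umono]
    exact Submodule.smul_mem _ _ (umono_mem_supported.2 h)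
  · rw [adXU_umono]
    refine Submodule.sum_mem _ fun j hj => Submodule.smul_mem _ _ (umono_mem_supported.2 ?_)
    exact hS.succ_mem_of_lt (Finset.mem_range.1 hj) h
  · rw [ucopComp_umono]
    split_ifs
    · exact Submodule.smul_mem _ _
        (umono_mem_supported.2 (hS.mem_of_le (Nat.sub_le _ _) (Nat.sub_le _ _) h))
    · exact Submodule.zero_mem _

theorem adH_apply (v : UU k) (p : ℕ × ℕ) : adH k v p = p.1 * v p := by
  induction v using Finsupp.induction_linear with
  | zero => simp
  | add f g hf hg => simp [hf, hg, mul_add]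
  | single q c =>
    by_cases h : q = p
    · subst h
      simp [adH, umono, mul_comm]
    · simp [adH, umono, Finsupp.single_eq_of_ne' h]

theorem ucopComp_zero_one_apply (v : UU k) (a b : ℕ) :
    ucopComp k 0 1 v (a, b) = (b + 1) * v (a, b + 1) := by
  induction v using Finsupp.induction_linear with
  | zero => simp
  | add f g hf hg => simp [hf, hg, mul_add]
  | single q c =>
    obtain ⟨n, m⟩ := q
    rcases m with _ | m
    · simp [ucopComp]
    · by_cases h : n = a ∧ m = b
      · obtain ⟨rfl, rfl⟩ := h
        simp [ucopComp, umono, mul_comm c, add_mul]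
      · have h1 : ((n, m) : ℕ × ℕ) ≠ (a, b) := by simpa using h
        have h2 : ((n, m + 1) : ℕ × ℕ) ≠ (a, b + 1) := by simpa using h
        simp [ucopComp, umono, Finsupp.single_eq_of_ne' h1, Finsupp.single_eq_of_ne' h2]

variable [CharZero k]

/-- A crossed submodule containing a vector `X^a p(H)` with `deg p = d` contains all
`X^a H^b`, `b ≤ d`. -/
theorem IsCrossedU.supported_column_le {L : Submodule k (UU k)} (hL : IsCrossedU k L) (a d : ℕ) :
    ∀ v ∈ L, v ∈ Finsupp.supported k k {p : ℕ × ℕ | p.1 = a ∧ p.2 ≤ d} → v (a, d) ≠ 0 →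
      Finsupp.supported k k {p : ℕ × ℕ | p.1 = a ∧ p.2 ≤ d} ≤ L := by
  induction d with
  | zero =>
    intro v hv hs hne
    have hv' : v = v (a, 0) • umono k a 0 := by
      ext ⟨n, m⟩
      by_cases h : ((a, 0) : ℕ × ℕ) = (n, m)
      · rw [← h]; simp [umono]
      · have : v (n, m) = 0 := (Finsupp.mem_supported' k v).1 hs _ (by
          rintro ⟨h1, h2⟩
          exact h (by simp only at h1 h2; ext <;> simp <;> omega))
        simp [umono, this, Finsupp.single_eq_of_ne' h]
    have hm : umono k a 0 ∈ L := (Submodule.smul_mem_iff L hne).1 (hv' ▸ hv)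
    intro w hw
    refine map_mem_of_mem_supported (f := LinearMap.id) ?_ hw
    rintro n m ⟨h1, h2⟩
    simp only at h1 h2
    obtain rfl : m = 0 := by omega
    subst h1
    exact hm
  | succ d ih =>
    intro v hv hs hne
    have hlow := ih _ (hL.2.2 0 1 v hv) (by
      rw [Finsupp.mem_supported'] at hs ⊢
      rintro ⟨n, m⟩ hp
      rw [ucopComp_zero_one_apply,
        hs (n, m + 1) fun h => hp ⟨h.1, Nat.succ_le_succ_iff.1 h.2⟩, mul_zero]) (by
      rw [ucopComp_zero_one_apply]
      exact mul_ne_zero (Nat.cast_add_one_ne_zero d) hne)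
    have hm : umono k a (d + 1) ∈ L := by
      have h1 : v - v (a, d + 1) • umono k a (d + 1) ∈ L := hlow <| by
        rw [Finsupp.mem_supported'] at hs ⊢
        rintro ⟨n, m⟩ hp
        by_cases h : ((a, d + 1) : ℕ × ℕ) = (n, m)
        · rw [← h]; simp [umono]
        · have : v (n, m) = 0 := hs _ (by
            rintro ⟨h1, h2⟩
            simp only [Set.mem_ofPred_eq, Prod.mk.injEq, not_and] at hp h h1 h2
            have := hp h1
            have := h h1.symm
            omega)
          simp [umono, this, Finsupp.single_eq_of_ne' h]
      exact (Submodule.smul_mem_iff L hne).1 ((Submodule.sub_mem_iff_right L hv).1 h1)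
    intro w hw
    refine map_mem_of_mem_supported (f := LinearMap.id) ?_ hw
    rintro n m ⟨h1, h2⟩
    simp only at h1 h2
    subst h1
    rcases h2.lt_or_eq with h | rfl
    · exact hlow (umono_mem_supported.2 ⟨rfl, Nat.lt_succ_iff.1 h⟩)
    · exact hm

theorem IsCrossedU.umono_mem {L : Submodule k (UU k)} (hL : IsCrossedU k L) {v : UU k}
    (hv : v ∈ L) {a b : ℕ} (hne : v (a, b) ≠ 0) : umono k a b ∈ L := by
  induction hc : v.support.card using Nat.strong_induction_on generalizing v with
  | _ c ih =>
  by_cases hq : ∃ q ∈ v.support, q.1 ≠ a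
  · obtain ⟨q, hqs, hqa⟩ := hq
    have happ : ∀ p, (adH k v - (q.1 : k) • v) p = ((p.1 : k) - q.1) * v p := fun p => by
      simp [adH_apply, sub_mul]
    refine ih _ ?_ (L.sub_mem (hL.1 v hv) (L.smul_mem (q.1 : k) hv)) ?_ rfl
    · rw [← hc]
      refine Finset.card_lt_card (Finset.ssubset_iff_of_subset ?_ |>.2 ⟨q, hqs, ?_⟩)
      · intro p hp
        rw [Finsupp.mem_support_iff, happ] at hp
        exact Finsupp.mem_support_iff.2 (right_ne_zero_of_mul hp)
      · rw [Finsupp.notMem_support_iff, happ, sub_self, zero_mul]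
    · rw [happ]
      exact mul_ne_zero (sub_ne_zero.2 (Nat.cast_injective.ne hqa.symm)) hne
  · push Not at hq
    have hab : (a, b) ∈ v.support := Finsupp.mem_support_iff.2 hne
    obtain ⟨p, hp, hmax⟩ := v.support.exists_max_image Prod.snd ⟨_, hab⟩
    have hpa := hq p hp
    refine hL.supported_column_le a p.2 v hv ?_ ?_ (umono_mem_supported.2 ⟨rfl, hmax _ hab⟩)
    · exact (Finsupp.mem_supported k v).2 fun q hqs => ⟨hq q hqs, hmax q hqs⟩
    · rw [← hpa]
      exact Finsupp.mem_support_iff.1 hp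

theorem IsCrossedU.eq_supported {L : Submodule k (UU k)} (hL : IsCrossedU k L) :
    L = Finsupp.supported k k {p : ℕ × ℕ | umono k p.1 p.2 ∈ L} := by
  refine le_antisymm (fun v hv => ?_) (fun v hv => ?_)
  · exact (Finsupp.mem_supported k v).2 fun p hp =>
      hL.umono_mem hv (Finsupp.mem_support_iff.1 hp)
  · exact map_mem_of_mem_supported (f := LinearMap.id) (fun a b h => h) hv

theorem IsCrossedU.isStair {L : Submodule k (UU k)} (hL : IsCrossedU k L) :
    IsStair {p : ℕ × ℕ | umono k p.1 p.2 ∈ L} := by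
  refine ⟨fun a b h => hL.umono_mem (hL.2.2 1 0 _ h) ?_,
    fun a b h => hL.umono_mem (hL.2.1 _ h) ?_⟩
  · rw [ucopComp_umono]
    simp [umono, Nat.cast_add_one_ne_zero]
  · rw [adXU_umono, Finset.sum_range_succ, Finsupp.add_apply, Finsupp.finsetSum_apply,
      Finset.sum_eq_zero]
    · simp only [umono, Nat.choose_succ_self_right, Nat.cast_add, Nat.cast_one,
        Finsupp.smul_apply, Finsupp.single_eq_same, smul_eq_mul, mul_one, zero_add]
      exact neg_ne_zero.2 (Nat.cast_add_one_ne_zero b)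
    · intro j hj
      have h1 : ((a + 1, j) : ℕ × ℕ) ≠ (a + 1, b) := by
        simpa using (Finset.mem_range.1 hj).ne
      simp [umono, Finsupp.single_eq_of_ne' h1]

end Linear

/-- lemma 3.3: the proper left crossed
`U(b_+)`-submodules (left adjoint action, left regular coaction) are exactly
the `L_(l,I)` for unique pairs `(l, I)` with `l ∈ ℕ₀` and `I ⊂ ℕ` finite;
`L_(l,I)` is finite-dimensional iff `l = 0`, with `dim L_(0,I) = ∑_{n ∈ I} n`. -/
theorem classification_crossed_UB (k : Type*) [Field k] [CharZero k] :
    (∀ L : Submodule k (UU k), L ≠ ⊤ →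
      (IsCrossedU k L ↔
        ∃! lI : ℕ × Finset ℕ, 0 ∉ lI.2 ∧ L = Lsub k lI.1 lI.2)) ∧
    (∀ (l : ℕ) (I : Finset ℕ), 0 ∉ I →
      IsCrossedU k (Lsub k l I) ∧ Lsub k l I ≠ ⊤ ∧
      (FiniteDimensional k (Lsub k l I) ↔ l = 0) ∧
      (l = 0 → Module.finrank k (Lsub k 0 I) = ∑ n ∈ I, n)) := by
  refine ⟨fun L hL => ⟨fun h => ?_, ?_⟩, fun l I _ => ⟨?_, ?_, ?_, ?_⟩⟩
  · have hne : {p : ℕ × ℕ | umono k p.1 p.2 ∈ L} ≠ Set.univ := fun hu => hL <| by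
      rw [h.eq_supported, hu, Finsupp.supported_univ]
    obtain ⟨l, I, h0, hS⟩ := h.isStair.exists_eq_stair hne
    have hLs : L = Lsub k l I := by rw [Lsub_eq_supported, ← hS, ← h.eq_supported]
    refine ⟨(l, I), ⟨h0, hLs⟩, ?_⟩
    rintro ⟨l', I'⟩ ⟨h0', hLs'⟩
    rw [hLs, Lsub_eq_supported, Lsub_eq_supported] at hLs'
    obtain ⟨rfl, rfl⟩ := stair_injective h0 h0' (supported_injective hLs')
    rfl
  · rintro ⟨lI, ⟨-, rfl⟩, -⟩
    rw [Lsub_eq_supported]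
    exact isCrossedU_supported (isStair_stair _ _)
  · rw [Lsub_eq_supported]
    exact isCrossedU_supported (isStair_stair _ _)
  · rw [Lsub_eq_supported]
    intro h
    refine notMem_stair_of_card_le (a := 0) (le_refl (l + I.card)) ?_
    rw [← umono_mem_supported (k := k), h]
    exact Submodule.mem_top
  · rw [Lsub_eq_supported, finiteDimensional_supported_iff, finite_stair_iff]
  · intro _
    rw [Lsub_eq_supported, finrank_supported, ncard_stair_zero]

end UBorel
end
end

section
/- There is precisely one left ideal M ⊆ ker ε ⊂ U(b_+) whose associated first-order differential calculus Γ = (ker ε / M) ⊗ U(b_+) is 2-dimensional and satisfies d(P(H)) = dH · (∂P/∂H)(H) and d(P(X)) = dX · (∂P/∂X)(X) for all polynomials P, together with dX ≠ 0 and dH ≠ 0; namely, M is the ideal of ker ε generated by H^2, XH, and X^2. The resulting calculus obeys [a, dH] = 0 for all a ∈ U(b_+), [X, dX] = 0, [H, dX] = dX, and d(:f:) = dH · :(∂f/∂H): + dX · :(∂f/∂X): for all f ∈ k[X,H]. -/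
open scoped TensorProduct

noncomputable section

namespace UBorel

variable (k : Type*) [Field k] [CharZero k]

/-- Left multiplication by the monomial `X^{p.1} H^{p.2}`:
`(X^n H^m)(X^r H^s) = ∑_{j≤m} (m choose j) r^{m-j} X^{n+r} H^{j+s}`
(from `H^m X^r = X^r (H+r)^m`). -/
def ulmulMono (p : ℕ × ℕ) : UU k →ₗ[k] UU k :=
  Finsupp.lsum k fun r =>
    LinearMap.toSpanSingleton k (UU k)
      (∑ j ∈ Finset.range (p.2 + 1),
        ((p.2.choose j : k) * (r.1 : k) ^ (p.2 - j)) • umono k (p.1 + r.1) (j + r.2))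

/-- The multiplication of `U(b_+)` as a bilinear map. -/
def umul : UU k →ₗ[k] UU k →ₗ[k] UU k :=
  Finsupp.lsum k fun p =>
    LinearMap.toSpanSingleton k (UU k →ₗ[k] UU k) (ulmulMono k p)

/-- The coproduct of `U(b_+)` (with `X` and `H` primitive):
`Δ(X^n H^m) = ∑_{i≤n} ∑_{j≤m} (n choose i)(m choose j) X^i H^j ⊗ X^{n-i} H^{m-j}`. -/
def ucop : UU k →ₗ[k] UU k ⊗[k] UU k :=
  Finsupp.lsum k fun p =>
    LinearMap.toSpanSingleton k (UU k ⊗[k] UU k)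
      (∑ i ∈ Finset.range (p.1 + 1), ∑ j ∈ Finset.range (p.2 + 1),
        ((p.1.choose i * p.2.choose j : ℕ) : k) •
          (umono k i j ⊗ₜ[k] umono k (p.1 - i) (p.2 - j)))

/-- Componentwise multiplication on `U(b_+) ⊗ U(b_+)`. -/
def utmul2 : UU k ⊗[k] UU k →ₗ[k] UU k ⊗[k] UU k →ₗ[k] UU k ⊗[k] UU k :=
  TensorProduct.map₂ (umul k) (umul k)

/-- The subspace of `W = U(b_+) ⊗ U(b_+)` by which one quotients to obtain
`Γ = (ker ε / M) ⊗ U(b_+)` (using `ker ε / M ≅ U(b_+)/(k·1 + M)`). -/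
def ucalcRel (M : Set (UU k)) : Submodule k (UU k ⊗[k] UU k) :=
  Submodule.span k
    {w | ∃ x b : UU k, (x ∈ M ∨ x = umono k 0 0) ∧ w = x ⊗ₜ[k] b}

/-- The differential `d a = π(Δa - 1 ⊗ a)`, before quotienting. -/
def udd (a : UU k) : UU k ⊗[k] UU k := ucop k a - umono k 0 0 ⊗ₜ[k] a

/-- The left action of `a` on `Γ`: `a · (v ⊗ b) = (a₍₁₎ v) ⊗ (a₍₂₎ b)`. -/
def ulact (a : UU k) (w : UU k ⊗[k] UU k) : UU k ⊗[k] UU k :=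
  utmul2 k (ucop k a) w

/-- The right action of `a` on `Γ`: `(v ⊗ b) · a = v ⊗ (b a)`. -/
def uract (w : UU k ⊗[k] UU k) (a : UU k) : UU k ⊗[k] UU k :=
  utmul2 k w (umono k 0 0 ⊗ₜ[k] a)

/-- The left ideal generated by a subset. -/
def uleftIdeal (S : Set (UU k)) : Submodule k (UU k) :=
  sInf {M : Submodule k (UU k) | S ⊆ M ∧ ∀ a : UU k, ∀ v ∈ M, umul k a v ∈ M}

/-- Being a left ideal. -/
def IsLeftIdeal (M : Submodule k (UU k)) : Prop :=
  ∀ a : UU k, ∀ v ∈ M, umul k a v ∈ M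

/-- The codimension of `M ⊆ ker ε` inside `ker ε`, computed via the canonical
identification `ker ε / M ≅ U(b_+)/(k·1 + M)`. -/
abbrev ucodimE (M : Submodule k (UU k)) : ℕ :=
  Module.finrank k (UU k ⧸ (Submodule.span k {umono k 0 0} ⊔ M))

/-- Finite codimension of `M ⊆ ker ε` inside `ker ε`. -/
abbrev uFinCodimE (M : Submodule k (UU k)) : Prop :=
  FiniteDimensional k (UU k ⧸ (Submodule.span k {umono k 0 0} ⊔ M))

/-- The element `P(H) ∈ U(b_+)` for a polynomial `P`. -/
def PofH (P : Polynomial k) : UU k := P.sum fun i c => c • umono k 0 i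

/-- The element `P(X) ∈ U(b_+)` for a polynomial `P`. -/
def PofX (P : Polynomial k) : UU k := P.sum fun i c => c • umono k i 0

/-- The commutative polynomial algebra `k[X, H]`, an element being a finite
sum `∑ c_{(a,b)} X^a H^b`. -/
abbrev Fu := (ℕ × ℕ) →₀ k

/-- Normal ordering `k[X,H] → U(b_+)`, `X^n H^m ↦ X^n H^m`. -/
def uno (f : Fu k) : UU k := f.sum fun p c => c • umono k p.1 p.2

/-- The partial derivative `∂/∂X` on `k[X,H]`. -/
def pdX (f : Fu k) : Fu k :=
  f.sum fun p c => Finsupp.single (p.1 - 1, p.2) (c * (p.1 : k))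

/-- The partial derivative `∂/∂H` on `k[X,H]`. -/
def pdH (f : Fu k) : Fu k :=
  f.sum fun p c => Finsupp.single (p.1, p.2 - 1) (c * (p.2 : k))

end UBorel

namespace UBorel

/-- The property, for a left ideal `M ⊆ ker ε ⊂ U(b_+)`, that the associated
first-order differential calculus `Γ = (ker ε / M) ⊗ U(b_+)` (realised as
`U(b_+) ⊗ U(b_+)` modulo `ucalcRel M`) is 2-dimensional, has `dX ≠ 0` and
`dH ≠ 0`, and satisfies the classical derivation conditions
`d(P(H)) = dH · P'(H)` and `d(P(X)) = dX · P'(X)` for all polynomials `P`. -/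
def IsClassicalTwoDimCalc (k : Type*) [Field k] [CharZero k]
    (M : Submodule k (UU k)) : Prop :=
  IsLeftIdeal k M ∧ M ≤ LinearMap.ker (ucou k) ∧
  uFinCodimE k M ∧ ucodimE k M = 2 ∧
  udd k (umono k 1 0) ∉ ucalcRel k (M : Set (UU k)) ∧
  udd k (umono k 0 1) ∉ ucalcRel k (M : Set (UU k)) ∧
  (∀ P : Polynomial k,
    udd k (PofH k P) - uract k (udd k (umono k 0 1)) (PofH k P.derivative) ∈
      ucalcRel k (M : Set (UU k))) ∧
  (∀ P : Polynomial k,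
    udd k (PofX k P) - uract k (udd k (umono k 1 0)) (PofX k P.derivative) ∈
      ucalcRel k (M : Set (UU k)))

section Helpers

variable {k : Type*} [Field k]

lemma UU_induction {P : UU k → Prop} (f : UU k) (h0 : P 0)
    (hadd : ∀ f g, P f → P g → P (f + g)) (hmono : ∀ n m (c : k), P (c • umono k n m)) : P f := by
  induction f using Finsupp.induction_linear with
  | zero => exact h0
  | add f g hf hg => exact hadd f g hf hg
  | single p c => simpa [umono] using hmono p.1 p.2 c

lemma umul_umono (n m r s : ℕ) :
    umul k (umono k n m) (umono k r s) = ∑ j ∈ Finset.range (m + 1),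
      ((m.choose j : k) * (r : k) ^ (m - j)) • umono k (n + r) (j + s) := by
  simp [umul, ulmulMono, umono]

lemma umul_umono_zero_left (n r s : ℕ) :
    umul k (umono k n 0) (umono k r s) = umono k (n + r) s := by
  simp [umul_umono]

lemma umul_umono_zero_right (n m s : ℕ) :
    umul k (umono k n m) (umono k 0 s) = umono k n (m + s) := by
  rw [umul_umono, Finset.sum_range_succ, Finset.sum_eq_zero]
  · simp
  · intro j hj
    have : m - j ≠ 0 := by have := Finset.mem_range.1 hj; omega
    simp [this]

lemma umul_H_umono (r s : ℕ) :
    umul k (umono k 0 1) (umono k r s) = (r : k) • umono k r s + umono k r (s + 1) := by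
  simp [umul_umono, Finset.sum_range_succ, add_comm 1 s]

lemma umul_one (a : UU k) : umul k a (umono k 0 0) = a := by
  induction a using UU_induction with
  | h0 => simp
  | hadd f g hf hg => simp [hf, hg]
  | hmono n m c => simp [umul_umono_zero_right]

lemma one_umul (a : UU k) : umul k (umono k 0 0) a = a := by
  induction a using UU_induction with
  | h0 => simp
  | hadd f g hf hg => simp only [map_add, hf, hg]
  | hmono n m c => simp [umul_umono_zero_left]

lemma uract_tmul (x b a : UU k) : uract k (x ⊗ₜ[k] b) a = x ⊗ₜ[k] umul k b a := by
  simp [uract, utmul2, umul_one]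

lemma ucop_umono (n m : ℕ) :
    ucop k (umono k n m) = ∑ i ∈ Finset.range (n + 1), ∑ j ∈ Finset.range (m + 1),
      ((n.choose i * m.choose j : ℕ) : k) • (umono k i j ⊗ₜ[k] umono k (n - i) (m - j)) := by
  simp [ucop, umono]

-- `rw` and `simp` do not see through the instances on `UU k ⊗[k] UU k` to apply the general forms
-- of the next two lemmas.
lemma utensor_add_sub_cancel_left (a b : UU k ⊗[k] UU k) : a + b - a = b :=
  add_sub_cancel_left a b

lemma utensor_sub_zero (a : UU k ⊗[k] UU k) : a - 0 = a := sub_zero a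

lemma udd_H : udd k (umono k 0 1) = umono k 0 1 ⊗ₜ[k] umono k 0 0 := by
  simp [udd, ucop_umono, Finset.sum_range_succ, utensor_add_sub_cancel_left]

lemma udd_X : udd k (umono k 1 0) = umono k 1 0 ⊗ₜ[k] umono k 0 0 := by
  simp [udd, ucop_umono, Finset.sum_range_succ, utensor_add_sub_cancel_left]

lemma uract_udd_H (a : UU k) : uract k (udd k (umono k 0 1)) a = umono k 0 1 ⊗ₜ[k] a := by
  rw [udd_H, uract_tmul, one_umul]

lemma uract_udd_X (a : UU k) : uract k (udd k (umono k 1 0)) a = umono k 1 0 ⊗ₜ[k] a := by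
  rw [udd_X, uract_tmul, one_umul]

lemma uno_eq (f : Fu k) : uno k f = f := by
  simp [uno, umono]

lemma ucou_apply (f : UU k) : ucou k f = f (0, 0) := by
  induction f using UU_induction with
  | h0 => simp
  | hadd f g hf hg => simp [hf, hg]
  | hmono n m c => by_cases h : (n, m) = (0, 0) <;> simp [ucou, umono, h]

/-- The span of the monomials of total degree at least two. -/
def degGeTwo (k : Type*) [Field k] : Submodule k (UU k) :=
  Finsupp.supported k k {p : ℕ × ℕ | 2 ≤ p.1 + p.2}

lemma umono_mem_degGeTwo {n m : ℕ} (h : 2 ≤ n + m) : umono k n m ∈ degGeTwo k :=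
  Finsupp.single_mem_supported k 1 (by simpa using h)

lemma degGeTwo_le {M : Submodule k (UU k)} (h : ∀ n m, 2 ≤ n + m → umono k n m ∈ M) :
    degGeTwo k ≤ M := by
  rw [degGeTwo, Finsupp.supported_eq_span_single, Submodule.span_le]
  rintro _ ⟨p, hp, rfl⟩
  exact h p.1 p.2 hp

lemma umul_mem_degGeTwo (a : UU k) {v : UU k} (hv : v ∈ degGeTwo k) :
    umul k a v ∈ degGeTwo k := by
  suffices degGeTwo k ≤ (degGeTwo k).comap (umul k a) from this hv
  refine degGeTwo_le fun r s hrs => ?_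
  rw [Submodule.mem_comap]
  induction a using UU_induction with
  | h0 => simp
  | hadd f g hf hg => simpa using add_mem hf hg
  | hmono n m c =>
    rw [map_smul, LinearMap.smul_apply, umul_umono]
    exact Submodule.smul_mem _ _ (Submodule.sum_mem _ fun j _ =>
      Submodule.smul_mem _ _ (umono_mem_degGeTwo (by omega)))

lemma degGeTwo_le_of_isLeftIdeal {M : Submodule k (UU k)} (hM : IsLeftIdeal k M)
    (hHH : umono k 0 2 ∈ M) (hXH : umono k 1 1 ∈ M) (hXX : umono k 2 0 ∈ M) :
    degGeTwo k ≤ M := by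
  refine degGeTwo_le fun n m hnm => ?_
  match m with
  | 0 =>
    obtain ⟨n, rfl⟩ := Nat.exists_eq_add_of_le' (show 2 ≤ n by omega)
    simpa [umul_umono_zero_left] using hM (umono k n 0) _ hXX
  | 1 =>
    obtain ⟨n, rfl⟩ := Nat.exists_eq_add_of_le' (show 1 ≤ n by omega)
    simpa [umul_umono_zero_left] using hM (umono k n 0) _ hXH
  | m + 2 => simpa [umul_umono_zero_right] using hM (umono k n m) _ hHH

lemma uleftIdeal_eq_degGeTwo :
    uleftIdeal k {umono k 0 2, umono k 1 1, umono k 2 0} = degGeTwo k := by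
  refine le_antisymm (sInf_le ⟨?_, fun a v hv => umul_mem_degGeTwo a hv⟩) (le_sInf ?_)
  · rintro _ (rfl | rfl | rfl) <;> exact umono_mem_degGeTwo (by norm_num)
  · rintro M ⟨hS, hM⟩
    exact degGeTwo_le_of_isLeftIdeal hM (hS (by simp)) (hS (by simp)) (hS (by simp))

lemma exists_eq_linear_add_degGeTwo (v : UU k) :
    ∃ w ∈ degGeTwo k, v = v (0, 0) • umono k 0 0 +
      (v (1, 0) • umono k 1 0 + v (0, 1) • umono k 0 1) + w := by
  refine ⟨v - (v (0, 0) • umono k 0 0 +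
      (v (1, 0) • umono k 1 0 + v (0, 1) • umono k 0 1)), ?_, by abel⟩
  rw [degGeTwo, Finsupp.mem_supported']
  rintro ⟨n, m⟩ hp
  obtain ⟨rfl, rfl⟩ | ⟨rfl, rfl⟩ | ⟨rfl, rfl⟩ :
      (n = 0 ∧ m = 0) ∨ (n = 1 ∧ m = 0) ∨ (n = 0 ∧ m = 1) := by
    simp only [Set.mem_ofPred_eq] at hp
    omega
  all_goals simp [umono]

lemma apply_eq_zero_of_mem_degGeTwo {v : UU k} (hv : v ∈ degGeTwo k) {n m : ℕ}
    (h : n + m < 2) : v (n, m) = 0 :=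
  (Finsupp.mem_supported' _ _).1 hv _ (by simpa using h)

/-- The coefficients of `X` and `H`. -/
def linearPart (k : Type*) [Field k] : UU k →ₗ[k] k × k :=
  (Finsupp.lapply (1, 0)).prod (Finsupp.lapply (0, 1))

lemma ker_linearPart :
    LinearMap.ker (linearPart k) = Submodule.span k {umono k 0 0} ⊔ degGeTwo k := by
  refine le_antisymm (fun v hv => ?_) (sup_le ?_ fun v hv => ?_)
  · obtain ⟨w, hw, h⟩ := exists_eq_linear_add_degGeTwo v
    have hv' : v (1, 0) = 0 ∧ v (0, 1) = 0 := by simpa [linearPart] using hv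
    rw [h, hv'.1, hv'.2]
    refine Submodule.add_mem_sup ?_ hw
    simpa using Submodule.smul_mem _ _ (Submodule.mem_span_singleton_self _)
  · rw [Submodule.span_singleton_le_iff_mem]
    simp [linearPart, umono]
  · simp [linearPart, apply_eq_zero_of_mem_degGeTwo hv]

lemma linearPart_surjective : Function.Surjective (linearPart k) := fun ⟨a, b⟩ =>
  ⟨a • umono k 1 0 + b • umono k 0 1, by simp [linearPart, umono]⟩

variable {M : Submodule k (UU k)}

lemma tmul_mem_ucalcRel {x : UU k} (hx : x ∈ M) (b : UU k) :
    x ⊗ₜ[k] b ∈ ucalcRel k (M : Set (UU k)) :=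
  Submodule.subset_span ⟨x, b, Or.inl hx, rfl⟩

lemma mem_of_mem_span_one_sup (hM : M ≤ LinearMap.ker (ucou k)) {x : UU k}
    (hx : x ∈ Submodule.span k {umono k 0 0} ⊔ M) (h0 : x (0, 0) = 0) : x ∈ M := by
  obtain ⟨y, hy, z, hz, rfl⟩ := Submodule.mem_sup.1 hx
  obtain ⟨c, rfl⟩ := Submodule.mem_span_singleton.1 hy
  have hz0 : z (0, 0) = 0 := by rw [← ucou_apply]; exact hM hz
  have hc : c = 0 := by simpa [umono, hz0] using h0
  simpa [hc] using hz

lemma mem_of_tmul_one_mem_ucalcRel (hM : M ≤ LinearMap.ker (ucou k)) {x : UU k}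
    (hw : x ⊗ₜ[k] umono k 0 0 ∈ ucalcRel k (M : Set (UU k))) (hx : x (0, 0) = 0) : x ∈ M := by
  refine mem_of_mem_span_one_sup hM ?_ hx
  let evalRight : UU k ⊗[k] UU k →ₗ[k] UU k :=
    TensorProduct.rid k (UU k) ∘ₗ (ucou k).lTensor (UU k)
  suffices h : ucalcRel k (M : Set (UU k)) ≤
      (Submodule.span k {umono k 0 0} ⊔ M).comap evalRight by
    simpa [evalRight, ucou_apply, umono] using h hw
  refine Submodule.span_le.2 ?_
  rintro _ ⟨y, b, hy, rfl⟩
  suffices y ∈ Submodule.span k {umono k 0 0} ⊔ M by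
    simpa [evalRight] using Submodule.smul_mem _ (ucou k b) this
  rcases hy with hy | rfl
  · exact Submodule.mem_sup_right hy
  · exact Submodule.mem_sup_left (Submodule.mem_span_singleton_self _)

lemma umono_tmul_mem_ucalcRel_degGeTwo {n m : ℕ} (h : 2 ≤ n + m) (b : UU k) :
    umono k n m ⊗ₜ[k] b ∈ ucalcRel k (degGeTwo k : Set (UU k)) :=
  tmul_mem_ucalcRel (umono_mem_degGeTwo h) b

lemma sum_range_range_eq_affine_add {A : Type*} [AddCommMonoid A] (F : ℕ → ℕ → A) (n m : ℕ)
    (hn : ∀ i j, n < i → F i j = 0) (hm : ∀ i j, m < j → F i j = 0) :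
    ∑ i ∈ Finset.range (n + 1), ∑ j ∈ Finset.range (m + 1), F i j =
      F 0 0 + (F 0 1 + F 1 0) +
        ∑ p ∈ Finset.range (n + 1) ×ˢ Finset.range (m + 1) with 2 ≤ p.1 + p.2, F p.1 p.2 := by
  rw [← Finset.sum_product', add_comm (F 0 0 + _),
    ← Finset.sum_filter_add_sum_filter_not _ fun p : ℕ × ℕ => 2 ≤ p.1 + p.2]
  congr 1
  trans ∑ p ∈ {(0, 0), (0, 1), (1, 0)}, F p.1 p.2
  · refine Finset.sum_congr_of_eq_on_inter ?_ ?_ fun _ _ _ => rfl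
    · rintro ⟨i, j⟩ hij hij'
      simp only [Finset.mem_filter, Finset.mem_insert, Finset.mem_singleton,
        Prod.mk.injEq] at hij hij'
      omega
    · rintro ⟨i, j⟩ hij hij'
      simp only [Finset.mem_filter, Finset.mem_product, Finset.mem_range, Finset.mem_insert,
        Finset.mem_singleton, Prod.mk.injEq] at hij hij'
      obtain h | h : n < i ∨ m < j := by omega
      · exact hn i j h
      · exact hm i j h
  · simp

lemma udd_umono_sub_mem (n m : ℕ) :
    udd k (umono k n m) - umono k 0 1 ⊗ₜ[k] ((m : k) • umono k n (m - 1)) -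
      umono k 1 0 ⊗ₜ[k] ((n : k) • umono k (n - 1) m) ∈
        ucalcRel k (degGeTwo k : Set (UU k)) := by
  rw [udd, ucop_umono, sum_range_range_eq_affine_add
    (fun i j => ((n.choose i * m.choose j : ℕ) : k) •
      (umono k i j ⊗ₜ[k] umono k (n - i) (m - j)))
    n m (fun i j h => by simp [Nat.choose_eq_zero_of_lt h])
    (fun i j h => by simp [Nat.choose_eq_zero_of_lt h])]
  simp only [Nat.choose_zero_right, Nat.choose_one_right, mul_one, one_mul, Nat.cast_one, one_smul,
    Nat.sub_zero, TensorProduct.tmul_smul, add_assoc, utensor_add_sub_cancel_left]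
  exact Submodule.sum_mem _ fun p hp => Submodule.smul_mem _ _
    (umono_tmul_mem_ucalcRel_degGeTwo (Finset.mem_filter.1 hp).2 _)

lemma pdH_add (f g : Fu k) : pdH k (f + g) = pdH k f + pdH k g :=
  Finsupp.sum_add_index' (by simp) (by simp [add_mul])

lemma pdX_add (f g : Fu k) : pdX k (f + g) = pdX k f + pdX k g :=
  Finsupp.sum_add_index' (by simp) (by simp [add_mul])

lemma pdH_smul_umono (c : k) (n m : ℕ) :
    pdH k (c • umono k n m) = c • (m : k) • umono k n (m - 1) := by
  simp [pdH, umono]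

lemma pdX_smul_umono (c : k) (n m : ℕ) :
    pdX k (c • umono k n m) = c • (n : k) • umono k (n - 1) m := by
  simp [pdX, umono]

/-- The Leibniz rule `d(:f:) = dH :∂f/∂H: + dX :∂f/∂X:`. -/
lemma udd_sub_mem (f : Fu k) :
    udd k f - umono k 0 1 ⊗ₜ[k] pdH k f - umono k 1 0 ⊗ₜ[k] pdX k f ∈
      ucalcRel k (degGeTwo k : Set (UU k)) := by
  induction f using UU_induction with
  | h0 => simp [udd, pdH, pdX]
  | hadd f g hf hg =>
    convert add_mem hf hg using 1
    simp only [udd, pdH_add, pdX_add, map_add, TensorProduct.tmul_add]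
    abel
  | hmono n m c =>
    convert Submodule.smul_mem _ c (udd_umono_sub_mem n m) using 1
    simp only [udd, pdH_smul_umono, pdX_smul_umono, map_smul, TensorProduct.tmul_smul, smul_sub]

lemma PofH_add (P Q : Polynomial k) : PofH k (P + Q) = PofH k P + PofH k Q :=
  Polynomial.sum_add_index _ _ _ (by simp) (by simp [add_smul])

lemma PofX_add (P Q : Polynomial k) : PofX k (P + Q) = PofX k P + PofX k Q :=
  Polynomial.sum_add_index _ _ _ (by simp) (by simp [add_smul])

lemma PofH_monomial (n : ℕ) (c : k) : PofH k (Polynomial.monomial n c) = c • umono k 0 n :=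
  Polynomial.sum_monomial_index _ _ (by simp)

lemma PofX_monomial (n : ℕ) (c : k) : PofX k (Polynomial.monomial n c) = c • umono k n 0 :=
  Polynomial.sum_monomial_index _ _ (by simp)

lemma pdH_PofH (P : Polynomial k) : pdH k (PofH k P) = PofH k P.derivative := by
  induction P using Polynomial.induction_on' with
  | add P Q hP hQ => simp [PofH_add, pdH_add, hP, hQ]
  | monomial n c =>
    simp [PofH_monomial, pdH_smul_umono, Polynomial.derivative_monomial, smul_smul]

lemma pdX_PofX (P : Polynomial k) : pdX k (PofX k P) = PofX k P.derivative := by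
  induction P using Polynomial.induction_on' with
  | add P Q hP hQ => simp [PofX_add, pdX_add, hP, hQ]
  | monomial n c =>
    simp [PofX_monomial, pdX_smul_umono, Polynomial.derivative_monomial, smul_smul]

lemma pdX_PofH (P : Polynomial k) : pdX k (PofH k P) = 0 := by
  induction P using Polynomial.induction_on' with
  | add P Q hP hQ => simp [PofH_add, pdX_add, hP, hQ]
  | monomial n c => simp [PofH_monomial, pdX_smul_umono]

lemma pdH_PofX (P : Polynomial k) : pdH k (PofX k P) = 0 := by
  induction P using Polynomial.induction_on' with
  | add P Q hP hQ => simp [PofX_add, pdH_add, hP, hQ]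
  | monomial n c => simp [PofX_monomial, pdH_smul_umono]

lemma degGeTwo_le_ker_ucou : degGeTwo k ≤ LinearMap.ker (ucou k) := fun v hv => by
  rw [LinearMap.mem_ker, ucou_apply]
  exact apply_eq_zero_of_mem_degGeTwo hv (by norm_num)

lemma notMem_of_udd_H_notMem (h : udd k (umono k 0 1) ∉ ucalcRel k (M : Set (UU k))) :
    umono k 0 1 ∉ M := fun hm => h (by rw [udd_H]; exact tmul_mem_ucalcRel hm _)

lemma notMem_of_udd_X_notMem (h : udd k (umono k 1 0) ∉ ucalcRel k (M : Set (UU k))) :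
    umono k 1 0 ∉ M := fun hm => h (by rw [udd_X]; exact tmul_mem_ucalcRel hm _)

/-- `[a, dH] = 0` in the calculus defined by `degGeTwo`. -/
lemma ulact_udd_H_sub_mem (a : UU k) :
    ulact k a (udd k (umono k 0 1)) - umono k 0 1 ⊗ₜ[k] a ∈
      ucalcRel k (degGeTwo k : Set (UU k)) := by
  rw [udd_H]
  induction a using UU_induction with
  | h0 => simp [ulact]
  | hadd f g hf hg =>
    convert add_mem hf hg using 1
    simp only [ulact, map_add, LinearMap.add_apply, TensorProduct.tmul_add]
    abel
  | hmono n m c =>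
    have hact : ulact k (umono k n m) (umono k 0 1 ⊗ₜ[k] umono k 0 0) =
        ∑ p ∈ Finset.range (n + 1) ×ˢ Finset.range (m + 1),
          ((n.choose p.1 * m.choose p.2 : ℕ) : k) •
            (umono k p.1 (p.2 + 1) ⊗ₜ[k] umono k (n - p.1) (m - p.2)) := by
      rw [Finset.sum_product]
      simp only [ulact, ucop_umono, utmul2, map_sum, map_smul, LinearMap.sum_apply,
        LinearMap.smul_apply, TensorProduct.map₂_apply_tmul, TensorProduct.map_tmul,
        umul_umono_zero_right, add_zero]
    have hmem : ulact k (umono k n m) (umono k 0 1 ⊗ₜ[k] umono k 0 0) -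
        umono k 0 1 ⊗ₜ[k] umono k n m ∈ ucalcRel k (degGeTwo k : Set (UU k)) := by
      rw [hact, ← Finset.add_sum_erase _ _ (a := (0, 0)) (by simp)]
      simp only [Nat.choose_zero_right, mul_one, Nat.cast_one, one_smul, zero_add, Nat.sub_zero,
        utensor_add_sub_cancel_left]
      refine Submodule.sum_mem _ fun p hp => Submodule.smul_mem _ _
        (umono_tmul_mem_ucalcRel_degGeTwo ?_ _)
      have : p ≠ (0, 0) := Finset.ne_of_mem_erase hp
      by_contra h
      exact this (Prod.ext (by simp; omega) (by simp; omega))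
    convert Submodule.smul_mem _ c hmem using 1
    simp only [ulact, map_smul, LinearMap.smul_apply, TensorProduct.tmul_smul, smul_sub]

/-- `[X, dX] = 0` in the calculus defined by `degGeTwo`. -/
lemma ulact_X_udd_X_sub_mem :
    ulact k (umono k 1 0) (udd k (umono k 1 0)) - umono k 1 0 ⊗ₜ[k] umono k 1 0 ∈
      ucalcRel k (degGeTwo k : Set (UU k)) := by
  rw [udd_X]
  convert umono_tmul_mem_ucalcRel_degGeTwo (k := k) (n := 2) (m := 0) le_rfl (umono k 0 0) using 1
  simp [ulact, utmul2, ucop_umono, Finset.sum_range_succ, umul_umono_zero_left,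
    utensor_add_sub_cancel_left]

/-- `[H, dX] = dX` in the calculus defined by `degGeTwo`. -/
lemma ulact_H_udd_X_sub_mem :
    ulact k (umono k 0 1) (udd k (umono k 1 0)) - umono k 1 0 ⊗ₜ[k] umono k 0 1 -
      udd k (umono k 1 0) ∈ ucalcRel k (degGeTwo k : Set (UU k)) := by
  rw [udd_X]
  convert umono_tmul_mem_ucalcRel_degGeTwo (k := k) (n := 1) (m := 1) le_rfl (umono k 0 0) using 1
  simp [ulact, utmul2, ucop_umono, Finset.sum_range_succ, umul_umono_zero_left, umul_one,
    umul_H_umono, TensorProduct.add_tmul]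
  abel

lemma finrank_quotient_degGeTwo :
    uFinCodimE k (degGeTwo k) ∧ ucodimE k (degGeTwo k) = 2 := by
  let e := (Submodule.quotEquivOfEq _ _ (ker_linearPart (k := k)).symm).trans
    ((linearPart k).quotKerEquivOfSurjective linearPart_surjective)
  exact ⟨Module.Finite.equiv e.symm, by simp [ucodimE, e.finrank_eq]⟩

lemma isClassicalTwoDimCalc_degGeTwo [CharZero k] : IsClassicalTwoDimCalc k (degGeTwo k) := by
  refine ⟨fun a v hv => umul_mem_degGeTwo a hv, degGeTwo_le_ker_ucou,
    finrank_quotient_degGeTwo.1, finrank_quotient_degGeTwo.2, fun h => ?_, fun h => ?_,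
    fun P => ?_, fun P => ?_⟩
  · rw [udd_X] at h
    have := apply_eq_zero_of_mem_degGeTwo (mem_of_tmul_one_mem_ucalcRel degGeTwo_le_ker_ucou h
      (by simp [umono])) (n := 1) (m := 0) (by norm_num)
    simp [umono] at this
  · rw [udd_H] at h
    have := apply_eq_zero_of_mem_degGeTwo (mem_of_tmul_one_mem_ucalcRel degGeTwo_le_ker_ucou h
      (by simp [umono])) (n := 0) (m := 1) (by norm_num)
    simp [umono] at this
  · have := udd_sub_mem (PofH k P)
    rw [pdH_PofH, pdX_PofH, TensorProduct.tmul_zero, utensor_sub_zero] at this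
    rwa [uract_udd_H]
  · have := udd_sub_mem (PofX k P)
    rw [pdX_PofX, pdH_PofX, TensorProduct.tmul_zero, utensor_sub_zero] at this
    rwa [uract_udd_X]

lemma udd_HH : udd k (umono k 0 2) - umono k 0 1 ⊗ₜ[k] ((2 : k) • umono k 0 1) =
    umono k 0 2 ⊗ₜ[k] umono k 0 0 := by
  simp [udd, ucop_umono, Finset.sum_range_succ]
  abel

lemma udd_XX : udd k (umono k 2 0) - umono k 1 0 ⊗ₜ[k] ((2 : k) • umono k 1 0) =
    umono k 2 0 ⊗ₜ[k] umono k 0 0 := by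
  simp [udd, ucop_umono, Finset.sum_range_succ]
  abel

/-- In a left ideal containing `H²` and `X²`, a nontrivial combination of `X`, `H` and `XH`
forces `XH` into the ideal. -/
lemma XH_mem_of_linear_combination (hM : IsLeftIdeal k M)
    (hHH : umono k 0 2 ∈ M) (hXX : umono k 2 0 ∈ M)
    {a b c : k}
    (h : a • umono k 1 0 + b • umono k 0 1 + c • umono k 1 1 ∈ M)
    (hne : ¬(a = 0 ∧ b = 0 ∧ c = 0)) :
    umono k 1 1 ∈ M := by
  by_contra hXH
  have hXHH : umono k 1 2 ∈ M := by
    simpa [umul_umono_zero_left] using hM (umono k 1 0) _ hHH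
  have hXXH : umono k 2 1 ∈ M := by
    have := hM (umono k 0 1) _ hXX
    rwa [umul_H_umono, M.add_mem_iff_right (M.smul_mem _ hXX)] at this
  have cancel {c : k} {x : UU k} (hx : x ∉ M) (h : c • x ∈ M) : c = 0 := by
    by_contra hc
    exact hx ((M.smul_mem_iff hc).1 h)
  have hb : b = 0 := by
    have := hM (umono k 1 0) _ h
    simp only [map_add, map_smul, umul_umono_zero_left] at this
    rw [M.add_mem_iff_left (M.smul_mem _ hXXH), M.add_mem_iff_right (M.smul_mem _ hXX)] at this
    exact cancel hXH this
  subst hb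
  have ha : a = 0 := by
    have := sub_mem (hM (umono k 0 1) _ h) h
    refine cancel hXH ((M.add_mem_iff_left (M.smul_mem c hXHH)).1 ?_)
    convert this using 1
    simp only [map_add, map_smul, umul_H_umono]
    simp only [Nat.cast_one, one_smul, zero_smul, smul_add]
    abel
  subst ha
  exact hne ⟨rfl, rfl, cancel hXH (by simpa using h)⟩

lemma eq_degGeTwo_of_isClassicalTwoDimCalc [CharZero k] (h : IsClassicalTwoDimCalc k M) :
    M = degGeTwo k := by
  obtain ⟨hM, hε, hfin, hcodim, hdX, hdH, hPH, hPX⟩ := h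
  have hX := notMem_of_udd_X_notMem hdX
  have hH := notMem_of_udd_H_notMem hdH
  have hHH : umono k 0 2 ∈ M := by
    have := hPH (Polynomial.monomial 2 1)
    rw [uract_udd_H] at this
    simp only [Polynomial.derivative_monomial, PofH_monomial, one_mul, one_smul, Nat.cast_ofNat,
      Nat.add_one_sub_one, udd_HH] at this
    exact mem_of_tmul_one_mem_ucalcRel hε this (by simp [umono])
  have hXX : umono k 2 0 ∈ M := by
    have := hPX (Polynomial.monomial 2 1)
    rw [uract_udd_X] at this
    simp only [Polynomial.derivative_monomial, PofX_monomial, one_mul, one_smul, Nat.cast_ofNat,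
      Nat.add_one_sub_one, udd_XX] at this
    exact mem_of_tmul_one_mem_ucalcRel hε this (by simp [umono])
  have hXH : umono k 1 1 ∈ M := by
    have hdep : ¬LinearIndependent k fun i : Fin 3 =>
        (Submodule.span k {umono k 0 0} ⊔ M).mkQ
          (![umono k 1 0, umono k 0 1, umono k 1 1] i) := fun hli => by
      have := hli.fintype_card_le_finrank
      rw [show Module.finrank k _ = 2 from hcodim, Fintype.card_fin] at this
      omega
    obtain ⟨g, hg, i, hi⟩ := Fintype.not_linearIndependent_iff.1 hdep
    rw [Fin.sum_univ_three] at hg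
    refine XH_mem_of_linear_combination hM hHH hXX
      (a := g 0) (b := g 1) (c := g 2)
      (mem_of_mem_span_one_sup hε ((Submodule.Quotient.mk_eq_zero _).1 hg) (by simp [umono])) ?_
    rintro ⟨h0, h1, h2⟩
    fin_cases i <;> contradiction
  have hle := degGeTwo_le_of_isLeftIdeal hM hHH hXH hXX
  refine le_antisymm (fun v hv => ?_) hle
  obtain ⟨w, hw, hvw⟩ := exists_eq_linear_add_degGeTwo v
  have hv0 : v (0, 0) = 0 := by rw [← ucou_apply]; exact hε hv
  rw [hv0, zero_smul, zero_add] at hvw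
  have hlin : v (1, 0) • umono k 1 0 + v (0, 1) • umono k 0 1 ∈ M :=
    (M.add_mem_iff_left (hle hw)).1 (hvw ▸ hv)
  have hv1 : v (1, 0) = 0 := by
    by_contra hne
    have := hM (umono k 0 1) _ hlin
    simp only [map_add, map_smul, umul_H_umono, Nat.cast_one, Nat.cast_zero, one_smul, zero_smul,
      zero_add, smul_add] at this
    rw [M.add_mem_iff_left (M.smul_mem _ hHH), M.add_mem_iff_left (M.smul_mem _ hXH)] at this
    exact hX ((M.smul_mem_iff hne).1 this)
  have hv2 : v (0, 1) = 0 := by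
    by_contra hne
    rw [hv1, zero_smul, zero_add] at hlin
    exact hH ((M.smul_mem_iff hne).1 hlin)
  rw [hvw, hv1, hv2]
  simpa using hw

end Helpers

/-- proposition 3.7: there is precisely one left ideal
`M ⊆ ker ε ⊂ U(b_+)` whose associated calculus is 2-dimensional with classical
derivations in `X` and `H` and `dX ≠ 0 ≠ dH`, namely the ideal generated by
`H², XH, X²`; the resulting calculus obeys `[a, dH] = 0`, `[X, dX] = 0`,
`[H, dX] = dX` and `d(:f:) = dH :∂f/∂H: + dX :∂f/∂X:`. -/
theorem natural_calculus_UB (k : Type*) [Field k] [CharZero k] :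
    -- existence and uniqueness
    (∃! M : Submodule k (UU k), IsClassicalTwoDimCalc k M) ∧
    -- the unique such ideal is generated by H², XH, X²
    (∀ M : Submodule k (UU k), IsClassicalTwoDimCalc k M →
      M = uleftIdeal k {umono k 0 2, umono k 1 1, umono k 2 0}) ∧
    -- the relations of the resulting calculus
    (IsClassicalTwoDimCalc k (uleftIdeal k {umono k 0 2, umono k 1 1, umono k 2 0}) ∧
     -- `[a, dH] = 0` for all `a`
     (∀ a : UU k,
       ulact k a (udd k (umono k 0 1)) - uract k (udd k (umono k 0 1)) a ∈
         ucalcRel k (uleftIdeal k {umono k 0 2, umono k 1 1, umono k 2 0} :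
           Set (UU k))) ∧
     -- `[X, dX] = 0`
     (ulact k (umono k 1 0) (udd k (umono k 1 0)) -
         uract k (udd k (umono k 1 0)) (umono k 1 0) ∈
       ucalcRel k (uleftIdeal k {umono k 0 2, umono k 1 1, umono k 2 0} :
         Set (UU k))) ∧
     -- `[H, dX] = dX`
     (ulact k (umono k 0 1) (udd k (umono k 1 0)) -
         uract k (udd k (umono k 1 0)) (umono k 0 1) - udd k (umono k 1 0) ∈
       ucalcRel k (uleftIdeal k {umono k 0 2, umono k 1 1, umono k 2 0} :
         Set (UU k))) ∧
     -- `d(:f:) = dH :∂f/∂H: + dX :∂f/∂X:`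
     (∀ f : Fu k,
       udd k (uno k f) - uract k (udd k (umono k 0 1)) (uno k (pdH k f)) -
           uract k (udd k (umono k 1 0)) (uno k (pdX k f)) ∈
         ucalcRel k (uleftIdeal k {umono k 0 2, umono k 1 1, umono k 2 0} :
           Set (UU k)))) := by
  simp only [uleftIdeal_eq_degGeTwo, uract_udd_H, uract_udd_X, uno_eq]
  exact ⟨⟨degGeTwo k, isClassicalTwoDimCalc_degGeTwo,
      fun M => eq_degGeTwo_of_isClassicalTwoDimCalc⟩,
    fun M => eq_degGeTwo_of_isClassicalTwoDimCalc, isClassicalTwoDimCalc_degGeTwo,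
    ulact_udd_H_sub_mem, ulact_X_udd_X_sub_mem, ulact_H_udd_X_sub_mem, udd_sub_mem⟩

end UBorel
end
end
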